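/- arXiv:math/0606506 — 2 statements merged into one kernel-verified Lean document; each statement's English description precedes it below -/
import Mathlib

section
/- There is a ℂ-algebra isomorphism from g_{p₊,p₋} onto the quotient of Ū_{Q₊}(sl₂; p₊) ⊗_ℂ Ū_{Q₋}(sl₂; p₋) by the two-sided ideal generated by k^{p₊} ⊗ 1 − 1 ⊗ k^{p₋}, where Q₊ = q₊^{p₋} and Q₋ = q₋^{p₊}, under which E₊ ↦ e ⊗ 1, F₊ ↦ f ⊗ 1, E₋ ↦ 1 ⊗ f, F₋ ↦ 1 ⊗ e, K^{p₋} ↦ k ⊗ 1, and K^{p₊} ↦ 1 ⊗ k^{-1}. -/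
noncomputable section

open scoped TensorProduct

/-- Generators of the quantum group `g_{p₊,p₋}`. -/
inductive QGGen : Type
  | Ep | Fp | Em | Fm | K

open FreeAlgebra QGGen

/-- `q = exp(iπ/p)`. -/
def rootOfUnity (p : ℕ) : ℂ := Complex.exp (Real.pi * Complex.I / p)

/-- The defining relations of the quantum group `g_{p₊,p₋}`. -/
inductive QGRel (pp pm : ℕ) : FreeAlgebra ℂ QGGen → FreeAlgebra ℂ QGGen → Prop
  | EpNil : QGRel pp pm (ι ℂ Ep ^ pp) 0
  | FpNil : QGRel pp pm (ι ℂ Fp ^ pp) 0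
  | EmNil : QGRel pp pm (ι ℂ Em ^ pm) 0
  | FmNil : QGRel pp pm (ι ℂ Fm ^ pm) 0
  | KOrd : QGRel pp pm (ι ℂ K ^ (2 * pp * pm)) 1
  | KEp : QGRel pp pm (ι ℂ K * ι ℂ Ep)
      (algebraMap ℂ (FreeAlgebra ℂ QGGen) ((rootOfUnity pp) ^ 2) * (ι ℂ Ep * ι ℂ K))
  | KFp : QGRel pp pm (ι ℂ K * ι ℂ Fp)
      (algebraMap ℂ (FreeAlgebra ℂ QGGen) (((rootOfUnity pp) ^ 2)⁻¹) * (ι ℂ Fp * ι ℂ K))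
  | KEm : QGRel pp pm (ι ℂ K * ι ℂ Em)
      (algebraMap ℂ (FreeAlgebra ℂ QGGen) ((rootOfUnity pm) ^ 2) * (ι ℂ Em * ι ℂ K))
  | KFm : QGRel pp pm (ι ℂ K * ι ℂ Fm)
      (algebraMap ℂ (FreeAlgebra ℂ QGGen) (((rootOfUnity pm) ^ 2)⁻¹) * (ι ℂ Fm * ι ℂ K))
  | EpEm : QGRel pp pm (ι ℂ Ep * ι ℂ Em) (ι ℂ Em * ι ℂ Ep)
  | FpFm : QGRel pp pm (ι ℂ Fp * ι ℂ Fm) (ι ℂ Fm * ι ℂ Fp)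
  | EpFm : QGRel pp pm (ι ℂ Ep * ι ℂ Fm) (ι ℂ Fm * ι ℂ Ep)
  | EmFp : QGRel pp pm (ι ℂ Em * ι ℂ Fp) (ι ℂ Fp * ι ℂ Em)
  | EpFp : QGRel pp pm (ι ℂ Ep * ι ℂ Fp - ι ℂ Fp * ι ℂ Ep)
      (algebraMap ℂ (FreeAlgebra ℂ QGGen)
          (((rootOfUnity pp) ^ pm - ((rootOfUnity pp) ^ pm)⁻¹)⁻¹) *
        (ι ℂ K ^ pm - ι ℂ K ^ (2 * pp * pm - pm)))
  | EmFm : QGRel pp pm (ι ℂ Em * ι ℂ Fm - ι ℂ Fm * ι ℂ Em)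
      (algebraMap ℂ (FreeAlgebra ℂ QGGen)
          (((rootOfUnity pm) ^ pp - ((rootOfUnity pm) ^ pp)⁻¹)⁻¹) *
        (ι ℂ K ^ pp - ι ℂ K ^ (2 * pp * pm - pp)))

/-- The quantum group `g_{p₊,p₋}`. -/
abbrev QG (pp pm : ℕ) : Type := RingQuot (QGRel pp pm)

/-- The image of a generator in `g_{p₊,p₋}`. -/
def gen (pp pm : ℕ) (x : QGGen) : QG pp pm :=
  RingQuot.mkAlgHom ℂ (QGRel pp pm) (ι ℂ x)

/-- Generators of the restricted quantum group `Ū_q(sl₂; p)`. -/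
inductive UGen : Type
  | e | f | k

/-- The defining relations of the restricted quantum group `Ū_q(sl₂; p)`. -/
inductive URel (q : ℂ) (p : ℕ) : FreeAlgebra ℂ UGen → FreeAlgebra ℂ UGen → Prop
  | eNil : URel q p (ι ℂ UGen.e ^ p) 0
  | fNil : URel q p (ι ℂ UGen.f ^ p) 0
  | kOrd : URel q p (ι ℂ UGen.k ^ (2 * p)) 1
  | ke : URel q p (ι ℂ UGen.k * ι ℂ UGen.e)
      (algebraMap ℂ (FreeAlgebra ℂ UGen) (q ^ 2) * (ι ℂ UGen.e * ι ℂ UGen.k))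
  | kf : URel q p (ι ℂ UGen.k * ι ℂ UGen.f)
      (algebraMap ℂ (FreeAlgebra ℂ UGen) ((q ^ 2)⁻¹) * (ι ℂ UGen.f * ι ℂ UGen.k))
  | ef : URel q p (ι ℂ UGen.e * ι ℂ UGen.f - ι ℂ UGen.f * ι ℂ UGen.e)
      (algebraMap ℂ (FreeAlgebra ℂ UGen) ((q - q⁻¹)⁻¹) *
        (ι ℂ UGen.k - ι ℂ UGen.k ^ (2 * p - 1)))

/-- The restricted quantum group `Ū_q(sl₂; p)`. -/
abbrev UQsl2 (q : ℂ) (p : ℕ) : Type := RingQuot (URel q p)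

/-- The image of a generator in `Ū_q(sl₂; p)`. -/
def ugen (q : ℂ) (p : ℕ) (x : UGen) : UQsl2 q p :=
  RingQuot.mkAlgHom ℂ (URel q p) (ι ℂ x)

/-- The relation generating the two-sided ideal `(k^{p₊} ⊗ 1 − 1 ⊗ k^{p₋})` in
`Ū_{Q₊}(sl₂; p₊) ⊗ Ū_{Q₋}(sl₂; p₋)`. -/
inductive KIdealRel (pp pm : ℕ) :
    (UQsl2 (rootOfUnity pp ^ pm) pp ⊗[ℂ] UQsl2 (rootOfUnity pm ^ pp) pm) →
    (UQsl2 (rootOfUnity pp ^ pm) pp ⊗[ℂ] UQsl2 (rootOfUnity pm ^ pp) pm) → Prop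
  | rel : KIdealRel pp pm
      ((ugen (rootOfUnity pp ^ pm) pp UGen.k ^ pp) ⊗ₜ[ℂ] 1 -
        1 ⊗ₜ[ℂ] (ugen (rootOfUnity pm ^ pp) pm UGen.k ^ pm)) 0

/-- The quotient of `Ū_{Q₊}(sl₂; p₊) ⊗ Ū_{Q₋}(sl₂; p₋)` by the two-sided ideal generated by
`k^{p₊} ⊗ 1 − 1 ⊗ k^{p₋}`. -/
abbrev UTensQuot (pp pm : ℕ) : Type := RingQuot (KIdealRel pp pm)

section QCommute

variable {A : Type*} [Ring A] [Algebra ℂ A] {c : ℂ} {k e y : A}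

lemma pow_mul_of_qcommute (h : k * e = c • (e * k)) (n : ℕ) :
    k ^ n * e = c ^ n • (e * k ^ n) := by
  induction n with
  | zero => simp
  | succ n ih =>
    rw [pow_succ k, mul_assoc, h, mul_smul_comm, ← mul_assoc, ih, smul_mul_assoc, smul_smul,
      mul_assoc, pow_succ' c]

lemma inv_mul_of_qcommute (hc : c ≠ 0) (h : k * e = c • (e * k)) (hyk : y * k = 1)
    (hky : k * y = 1) : y * e = c⁻¹ • (e * y) := by
  have : e * y = c • (y * e) := by
    calc e * y = y * (k * e) * y := by rw [← mul_assoc, hyk, one_mul]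
      _ = c • (y * e) := by
        rw [h, mul_smul_comm, smul_mul_assoc, mul_assoc, mul_assoc, hky, mul_one]
  rw [this, smul_smul, inv_mul_cancel₀ hc, one_smul]

end QCommute

lemma pow_pred_pow_pred {M : Type*} [Monoid M] {z : M} {n : ℕ} (hn : 2 ≤ n) (h : z ^ n = 1) :
    (z ^ (n - 1)) ^ (n - 1) = z := by
  obtain ⟨m, rfl⟩ := Nat.exists_eq_add_of_le' hn
  rw [← pow_mul, show (m + 2 - 1) * (m + 2 - 1) = (m + 2) * m + 1 by
    simp only [show m + 2 - 1 = m + 1 by omega]; ring, pow_add, pow_mul, h]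
  simp

lemma pow_bezout {M : Type*} [Monoid M] {x : M} {p p' a b m : ℕ} (hx : x ^ (2 * p) = 1)
    (hab : a * p' + b * p = 1 + 2 * p * p' * m) : x ^ (a * p' + b * p) = x := by
  rw [hab, pow_add, mul_assoc, pow_mul, hx, one_pow, pow_one, mul_one]

/-- The monomial `x ^ a * y ^ b` is a common root of `x` and `y`. -/
lemma mul_pow_bezout {M : Type*} [Monoid M] {x y : M} {p p' a b m : ℕ} (hxy : Commute x y)
    (hx : x ^ (2 * p) = 1) (h : x ^ p = y ^ p')
    (hab : a * p' + b * p = 1 + 2 * p * p' * m) : (x ^ a * y ^ b) ^ p' = x := by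
  rw [(hxy.pow_pow a b).mul_pow, ← pow_mul, ← pow_mul, mul_comm b, pow_mul y, ← h, ← pow_mul,
    ← pow_add, mul_comm p b, pow_bezout hx hab]

lemma sq_pow_bezout {q : ℂ} {p p' a b m : ℕ} (hq : q ^ (2 * p) = 1)
    (hab : a * p' + b * p = 1 + 2 * p * p' * m) : ((q ^ p') ^ 2) ^ a = q ^ 2 := by
  have h1 : (q ^ 2) ^ p = 1 := by rw [← pow_mul, hq]
  calc ((q ^ p') ^ 2) ^ a = (q ^ 2) ^ (a * p' + b * p) := by
        rw [pow_add, mul_comm b, pow_mul _ p, h1, one_pow, mul_one]; ring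
    _ = q ^ 2 := pow_bezout (by rw [mul_comm, pow_mul, h1, one_pow]) hab

lemma exists_bezout_modulo {p p' : ℕ} (hp : 2 ≤ p) (hp' : 2 ≤ p') (h : p.Coprime p') :
    ∃ a b m : ℕ, a * p' + b * p = 1 + 2 * p * p' * m := by
  obtain ⟨a, -, ha⟩ := Nat.exists_mul_mod_eq_one_of_coprime h.symm hp
  have hdiv := Nat.div_add_mod (p' * a) p
  obtain ⟨r, rfl⟩ := Nat.exists_eq_add_of_le' hp'
  generalize (r + 2) * a / p = c at hdiv
  rw [ha] at hdiv
  exact ⟨a, c * (2 * r + 3), c, by rw [mul_comm a, ← hdiv]; ring⟩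

lemma rootOfUnity_pow {p : ℕ} (hp : p ≠ 0) : rootOfUnity p ^ (2 * p) = 1 := by
  rw [rootOfUnity, ← Complex.exp_nat_mul, ← Complex.exp_two_pi_mul_I]
  congr 1
  push_cast
  field_simp

lemma rootOfUnity_ne_zero (p : ℕ) : rootOfUnity p ≠ 0 := Complex.exp_ne_zero _

/-- The elements `e`, `f`, `k` satisfy the defining relations of `Ū_q(sl₂; p)`. -/
structure IsUTriple {A : Type*} [Ring A] [Algebra ℂ A] (q : ℂ) (p : ℕ) (e f k : A) : Prop where
  e_pow : e ^ p = 0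
  f_pow : f ^ p = 0
  k_pow : k ^ (2 * p) = 1
  k_e : k * e = q ^ 2 • (e * k)
  k_f : k * f = (q ^ 2)⁻¹ • (f * k)
  e_f : e * f - f * e = (q - q⁻¹)⁻¹ • (k - k ^ (2 * p - 1))

namespace IsUTriple

variable {A B : Type*} [Ring A] [Algebra ℂ A] [Ring B] [Algebra ℂ B] {q : ℂ} {p : ℕ} {e f k : A}

lemma ugen (q : ℂ) (p : ℕ) :
    IsUTriple q p (ugen q p UGen.e) (ugen q p UGen.f) (ugen q p UGen.k) where
  e_pow := by simpa [_root_.ugen] using RingQuot.mkAlgHom_rel ℂ (URel.eNil (q := q) (p := p))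
  f_pow := by simpa [_root_.ugen] using RingQuot.mkAlgHom_rel ℂ (URel.fNil (q := q) (p := p))
  k_pow := by simpa [_root_.ugen] using RingQuot.mkAlgHom_rel ℂ (URel.kOrd (q := q) (p := p))
  k_e := by
    simpa only [_root_.ugen, ← Algebra.smul_def, map_mul, map_smul] using
      RingQuot.mkAlgHom_rel ℂ (URel.ke (q := q) (p := p))
  k_f := by
    simpa only [_root_.ugen, ← Algebra.smul_def, map_mul, map_smul] using
      RingQuot.mkAlgHom_rel ℂ (URel.kf (q := q) (p := p))
  e_f := by
    simpa only [_root_.ugen, ← Algebra.smul_def, map_mul, map_smul, map_sub, map_pow] using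
      RingQuot.mkAlgHom_rel ℂ (URel.ef (q := q) (p := p))

lemma map (h : IsUTriple q p e f k) (φ : A →ₐ[ℂ] B) : IsUTriple q p (φ e) (φ f) (φ k) where
  e_pow := by rw [← map_pow, h.e_pow, map_zero]
  f_pow := by rw [← map_pow, h.f_pow, map_zero]
  k_pow := by rw [← map_pow, h.k_pow, map_one]
  k_e := by rw [← map_mul, h.k_e, map_smul, map_mul]
  k_f := by rw [← map_mul, h.k_f, map_smul, map_mul]
  e_f := by rw [← map_mul, ← map_mul, ← map_sub, h.e_f, map_smul, map_sub, map_pow]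

lemma k_mul_pow (h : IsUTriple q p e f k) (hp : p ≠ 0) : k * k ^ (2 * p - 1) = 1 := by
  rw [← pow_succ', show 2 * p - 1 + 1 = 2 * p by omega, h.k_pow]

lemma pow_mul_k (h : IsUTriple q p e f k) (hp : p ≠ 0) : k ^ (2 * p - 1) * k = 1 := by
  rw [← pow_succ, show 2 * p - 1 + 1 = 2 * p by omega, h.k_pow]

lemma k_pow_pred_pow_pred (h : IsUTriple q p e f k) (hp : p ≠ 0) :
    (k ^ (2 * p - 1)) ^ (2 * p - 1) = k := pow_pred_pow_pred (by omega) h.k_pow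

lemma swap (h : IsUTriple q p e f k) (hp : p ≠ 0) (hq : q ≠ 0) :
    IsUTriple q p f e (k ^ (2 * p - 1)) where
  e_pow := h.f_pow
  f_pow := h.e_pow
  k_pow := by rw [← pow_mul, mul_comm, pow_mul, h.k_pow, one_pow]
  k_e := by
    simpa using inv_mul_of_qcommute (inv_ne_zero (pow_ne_zero 2 hq)) h.k_f (h.pow_mul_k hp)
      (h.k_mul_pow hp)
  k_f := inv_mul_of_qcommute (pow_ne_zero 2 hq) h.k_e (h.pow_mul_k hp) (h.k_mul_pow hp)
  e_f := by rw [h.k_pow_pred_pow_pred hp, ← neg_sub, h.e_f, ← smul_neg, neg_sub]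

/-- The algebra homomorphism out of `Ū_q(sl₂; p)` determined by the images of `e`, `f`, `k`. -/
def lift (h : IsUTriple q p e f k) : UQsl2 q p →ₐ[ℂ] A :=
  RingQuot.liftAlgHom ℂ ⟨FreeAlgebra.lift ℂ fun | UGen.e => e | UGen.f => f | UGen.k => k, by
    rintro _ _ (_ | _ | _ | _ | _ | _)
    · simpa using h.e_pow
    · simpa using h.f_pow
    · simpa using h.k_pow
    · simpa [Algebra.smul_def] using h.k_e
    · simpa [Algebra.smul_def] using h.k_f
    · simpa [Algebra.smul_def] using h.e_f⟩

@[simp] lemma lift_e (h : IsUTriple q p e f k) : h.lift (_root_.ugen q p UGen.e) = e := by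
  simp [lift, _root_.ugen]

@[simp] lemma lift_f (h : IsUTriple q p e f k) : h.lift (_root_.ugen q p UGen.f) = f := by
  simp [lift, _root_.ugen]

@[simp] lemma lift_k (h : IsUTriple q p e f k) : h.lift (_root_.ugen q p UGen.k) = k := by
  simp [lift, _root_.ugen]

end IsUTriple

lemma UQsl2.adjoin_eq_top (q : ℂ) (p : ℕ) :
    Algebra.adjoin ℂ (Set.range (ugen q p)) = ⊤ := by
  have : Set.range (ugen q p) =
      RingQuot.mkAlgHom ℂ (URel q p) '' Set.range (FreeAlgebra.ι ℂ) := by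
    rw [← Set.range_comp]; rfl
  rw [this, ← AlgHom.map_adjoin, FreeAlgebra.adjoin_range_ι, Algebra.map_top,
    AlgHom.range_eq_top]
  exact RingQuot.mkAlgHom_surjective ℂ _

lemma UQsl2.algHom_ext {A : Type*} [Ring A] [Algebra ℂ A] {q : ℂ} {p : ℕ}
    {φ ψ : UQsl2 q p →ₐ[ℂ] A} (h : ∀ x, φ (ugen q p x) = ψ (ugen q p x)) : φ = ψ :=
  AlgHom.ext_of_adjoin_eq_top (UQsl2.adjoin_eq_top q p) (by rintro _ ⟨x, rfl⟩; exact h x)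

/-- If the images of the generators commute then so do the images of the homomorphisms. -/
lemma UQsl2.commute_of_gen {A : Type*} [Ring A] [Algebra ℂ A] {q q' : ℂ} {p p' : ℕ}
    (φ : UQsl2 q p →ₐ[ℂ] A) (ψ : UQsl2 q' p' →ₐ[ℂ] A)
    (h : ∀ x y, Commute (φ (ugen q p x)) (ψ (ugen q' p' y))) (u : UQsl2 q p)
    (v : UQsl2 q' p') : Commute (φ u) (ψ v) := by
  have key : ∀ {q : ℂ} {p : ℕ} (φ : UQsl2 q p →ₐ[ℂ] A) (z : A),
      (∀ x, Commute (φ (ugen q p x)) z) → ∀ u, Commute (φ u) z := by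
    intro q p φ z hz u
    have hu : u ∈ Algebra.adjoin ℂ (Set.range (ugen q p)) := by
      rw [UQsl2.adjoin_eq_top]; trivial
    induction hu using Algebra.adjoin_induction with
    | mem x hx => obtain ⟨x, rfl⟩ := hx; exact hz x
    | algebraMap r => rw [AlgHom.commutes]; exact Algebra.commute_algebraMap_left r z
    | add x y _ _ hx hy => rw [map_add]; exact hx.add_left hy
    | mul x y _ _ hx hy => rw [map_mul]; exact hx.mul_left hy
  exact key φ _ (fun x => (key ψ _ (fun y => (h x y).symm) v).symm) u

/-- The elements `E`, `F`, `E'`, `F'`, `K` satisfy the defining relations of `g_{p,p'}`. -/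
structure IsQGTuple {A : Type*} [Ring A] [Algebra ℂ A] (p p' : ℕ) (E F E' F' K : A) : Prop where
  E_pow : E ^ p = 0
  F_pow : F ^ p = 0
  E'_pow : E' ^ p' = 0
  F'_pow : F' ^ p' = 0
  K_pow : K ^ (2 * p * p') = 1
  K_E : K * E = rootOfUnity p ^ 2 • (E * K)
  K_F : K * F = (rootOfUnity p ^ 2)⁻¹ • (F * K)
  K_E' : K * E' = rootOfUnity p' ^ 2 • (E' * K)
  K_F' : K * F' = (rootOfUnity p' ^ 2)⁻¹ • (F' * K)
  E_E' : Commute E E'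
  F_F' : Commute F F'
  E_F' : Commute E F'
  E'_F : Commute E' F
  E_F : E * F - F * E = (rootOfUnity p ^ p' - (rootOfUnity p ^ p')⁻¹)⁻¹ •
    (K ^ p' - K ^ (2 * p * p' - p'))
  E'_F' : E' * F' - F' * E' = (rootOfUnity p' ^ p - (rootOfUnity p' ^ p)⁻¹)⁻¹ •
    (K ^ p - K ^ (2 * p * p' - p))

namespace IsQGTuple

variable {A : Type*} [Ring A] [Algebra ℂ A] {p p' : ℕ} {E F E' F' K : A}

lemma gen (p p' : ℕ) : IsQGTuple p p' (gen p p' Ep) (gen p p' Fp) (gen p p' Em) (gen p p' Fm)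
    (gen p p' QGGen.K) where
  E_pow := by simpa [_root_.gen] using RingQuot.mkAlgHom_rel ℂ (QGRel.EpNil (pp := p) (pm := p'))
  F_pow := by simpa [_root_.gen] using RingQuot.mkAlgHom_rel ℂ (QGRel.FpNil (pp := p) (pm := p'))
  E'_pow := by simpa [_root_.gen] using RingQuot.mkAlgHom_rel ℂ (QGRel.EmNil (pp := p) (pm := p'))
  F'_pow := by simpa [_root_.gen] using RingQuot.mkAlgHom_rel ℂ (QGRel.FmNil (pp := p) (pm := p'))
  K_pow := by simpa [_root_.gen] using RingQuot.mkAlgHom_rel ℂ (QGRel.KOrd (pp := p) (pm := p'))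
  K_E := by
    simpa only [_root_.gen, ← Algebra.smul_def, map_mul, map_smul] using
      RingQuot.mkAlgHom_rel ℂ (QGRel.KEp (pp := p) (pm := p'))
  K_F := by
    simpa only [_root_.gen, ← Algebra.smul_def, map_mul, map_smul] using
      RingQuot.mkAlgHom_rel ℂ (QGRel.KFp (pp := p) (pm := p'))
  K_E' := by
    simpa only [_root_.gen, ← Algebra.smul_def, map_mul, map_smul] using
      RingQuot.mkAlgHom_rel ℂ (QGRel.KEm (pp := p) (pm := p'))
  K_F' := by
    simpa only [_root_.gen, ← Algebra.smul_def, map_mul, map_smul] using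
      RingQuot.mkAlgHom_rel ℂ (QGRel.KFm (pp := p) (pm := p'))
  E_E' := by
    simpa only [_root_.gen, map_mul, Commute, SemiconjBy] using
      RingQuot.mkAlgHom_rel ℂ (QGRel.EpEm (pp := p) (pm := p'))
  F_F' := by
    simpa only [_root_.gen, map_mul, Commute, SemiconjBy] using
      RingQuot.mkAlgHom_rel ℂ (QGRel.FpFm (pp := p) (pm := p'))
  E_F' := by
    simpa only [_root_.gen, map_mul, Commute, SemiconjBy] using
      RingQuot.mkAlgHom_rel ℂ (QGRel.EpFm (pp := p) (pm := p'))
  E'_F := by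
    simpa only [_root_.gen, map_mul, Commute, SemiconjBy] using
      RingQuot.mkAlgHom_rel ℂ (QGRel.EmFp (pp := p) (pm := p'))
  E_F := by
    simpa only [_root_.gen, ← Algebra.smul_def, map_mul, map_smul, map_sub, map_pow] using
      RingQuot.mkAlgHom_rel ℂ (QGRel.EpFp (pp := p) (pm := p'))
  E'_F' := by
    simpa only [_root_.gen, ← Algebra.smul_def, map_mul, map_smul, map_sub, map_pow] using
      RingQuot.mkAlgHom_rel ℂ (QGRel.EmFm (pp := p) (pm := p'))

lemma symm (h : IsQGTuple p p' E F E' F' K) : IsQGTuple p' p E' F' E F K where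
  E_pow := h.E'_pow
  F_pow := h.F'_pow
  E'_pow := h.E_pow
  F'_pow := h.F_pow
  K_pow := by rw [mul_right_comm, h.K_pow]
  K_E := h.K_E'
  K_F := h.K_F'
  K_E' := h.K_E
  K_F' := h.K_F
  E_E' := h.E_E'.symm
  F_F' := h.F_F'.symm
  E_F' := h.E'_F
  E'_F := h.E_F'
  E_F := by rw [mul_right_comm, h.E'_F']
  E'_F' := by rw [mul_right_comm, h.E_F]

/-- The algebra homomorphism out of `g_{p,p'}` determined by the images of the generators. -/
def lift (h : IsQGTuple p p' E F E' F' K) : QG p p' →ₐ[ℂ] A :=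
  RingQuot.liftAlgHom ℂ ⟨FreeAlgebra.lift ℂ fun
    | Ep => E | Fp => F | Em => E' | Fm => F' | QGGen.K => K, by
    rintro _ _ (_ | _ | _ | _ | _ | _ | _ | _ | _ | _ | _ | _ | _ | _ | _)
    · simpa using h.E_pow
    · simpa using h.F_pow
    · simpa using h.E'_pow
    · simpa using h.F'_pow
    · simpa using h.K_pow
    · simpa [Algebra.smul_def] using h.K_E
    · simpa [Algebra.smul_def] using h.K_F
    · simpa [Algebra.smul_def] using h.K_E'
    · simpa [Algebra.smul_def] using h.K_F'
    · simpa using h.E_E'.eq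
    · simpa using h.F_F'.eq
    · simpa using h.E_F'.eq
    · simpa using h.E'_F.eq
    · simpa [Algebra.smul_def] using h.E_F
    · simpa [Algebra.smul_def] using h.E'_F'⟩

section

variable (h : IsQGTuple p p' E F E' F' K)

@[simp] lemma lift_Ep : h.lift (_root_.gen p p' Ep) = E := by simp [lift, _root_.gen]

@[simp] lemma lift_Fp : h.lift (_root_.gen p p' Fp) = F := by simp [lift, _root_.gen]

@[simp] lemma lift_Em : h.lift (_root_.gen p p' Em) = E' := by simp [lift, _root_.gen]

@[simp] lemma lift_Fm : h.lift (_root_.gen p p' Fm) = F' := by simp [lift, _root_.gen]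

@[simp] lemma lift_K : h.lift (_root_.gen p p' QGGen.K) = K := by simp [lift, _root_.gen]

end

/-- The first pair of generators, with `K ^ p'`, generates a restricted quantum group. -/
lemma isUTriple (h : IsQGTuple p p' E F E' F' K) :
    IsUTriple (rootOfUnity p ^ p') p E F (K ^ p') where
  e_pow := h.E_pow
  f_pow := h.F_pow
  k_pow := by rw [← pow_mul, mul_comm, h.K_pow]
  k_e := by rw [pow_mul_of_qcommute h.K_E, pow_right_comm]
  k_f := by rw [pow_mul_of_qcommute h.K_F, inv_pow, pow_right_comm]
  e_f := by
    rw [h.E_F, ← pow_mul]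
    congr 4
    rw [Nat.mul_sub, mul_one, mul_comm p']

lemma commute_pow_E' (h : IsQGTuple p p' E F E' F' K) (hp' : p' ≠ 0) :
    Commute (K ^ p') E' := by
  have := pow_mul_of_qcommute h.K_E' p'
  rwa [← pow_mul, rootOfUnity_pow hp', one_smul] at this

lemma commute_pow_F' (h : IsQGTuple p p' E F E' F' K) (hp' : p' ≠ 0) :
    Commute (K ^ p') F' := by
  have := pow_mul_of_qcommute h.K_F' p'
  rwa [inv_pow, ← pow_mul, rootOfUnity_pow hp', inv_one, one_smul] at this

end IsQGTuple

lemma QG.algHom_ext {A : Type*} [Ring A] [Algebra ℂ A] {p p' : ℕ} {φ ψ : QG p p' →ₐ[ℂ] A}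
    (h : ∀ x, φ (gen p p' x) = ψ (gen p p' x)) : φ = ψ :=
  RingQuot.ringQuot_ext' ℂ _ _ (FreeAlgebra.hom_ext (funext h))

/-- Two commuting restricted quantum groups with `x ^ p = y ^ p'` produce `g_{p,p'}`, in which
`K` is the common root `x ^ a * y ^ b` of `x` and `y`. -/
lemma IsUTriple.isQGTuple {A : Type*} [Ring A] [Algebra ℂ A] {p p' a b m : ℕ}
    {E F x E' F' y : A} (h : IsUTriple (rootOfUnity p ^ p') p E F x)
    (h' : IsUTriple (rootOfUnity p' ^ p) p' E' F' y) (hp : p ≠ 0) (hp' : p' ≠ 0)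
    (hEE : Commute E E') (hEF : Commute E F') (hEy : Commute E y)
    (hFE : Commute F E') (hFF : Commute F F') (hFy : Commute F y)
    (hxE : Commute x E') (hxF : Commute x F') (hxy : Commute x y) (hpow : x ^ p = y ^ p')
    (hab : a * p' + b * p = 1 + 2 * p * p' * m) :
    IsQGTuple p p' E F E' F' (x ^ a * y ^ b) := by
  have hba : b * p + a * p' = 1 + 2 * p' * p * m := by rw [add_comm, hab]; ring
  have hKp' : (x ^ a * y ^ b) ^ p' = x := mul_pow_bezout hxy h.k_pow hpow hab
  have hKp : (x ^ a * y ^ b) ^ p = y := by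
    rw [(hxy.pow_pow a b).eq]
    exact mul_pow_bezout hxy.symm h'.k_pow hpow.symm hba
  have left : ∀ {c : ℂ} {z : A}, x ^ a * z = c • (z * x ^ a) → Commute z y →
      x ^ a * y ^ b * z = c • (z * (x ^ a * y ^ b)) := by
    intro c z hz hzy
    rw [mul_assoc, ← (hzy.pow_right b).eq, ← mul_assoc, hz, smul_mul_assoc, mul_assoc]
  have right : ∀ {c : ℂ} {z : A}, y ^ b * z = c • (z * y ^ b) → Commute x z →
      x ^ a * y ^ b * z = c • (z * (x ^ a * y ^ b)) := by
    intro c z hz hxz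
    rw [mul_assoc, hz, mul_smul_comm, ← mul_assoc, (hxz.pow_left a).eq, mul_assoc]
  refine ⟨h.e_pow, h.f_pow, h'.e_pow, h'.f_pow, ?_, left ?_ hEy, left ?_ hFy, right ?_ hxE,
    right ?_ hxF, hEE, hFF, hEF, hFE.symm, ?_, ?_⟩
  · rw [mul_comm, pow_mul, hKp', h.k_pow]
  · rw [pow_mul_of_qcommute h.k_e, sq_pow_bezout (rootOfUnity_pow hp) hab]
  · rw [pow_mul_of_qcommute h.k_f, inv_pow, sq_pow_bezout (rootOfUnity_pow hp) hab]
  · rw [pow_mul_of_qcommute h'.k_e, sq_pow_bezout (rootOfUnity_pow hp') hba]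
  · rw [pow_mul_of_qcommute h'.k_f, inv_pow, sq_pow_bezout (rootOfUnity_pow hp') hba]
  · rw [h.e_f, show 2 * p * p' - p' = p' * (2 * p - 1) by
      rw [Nat.mul_sub, mul_one, mul_comm p'], pow_mul, hKp']
  · rw [h'.e_f, show 2 * p * p' - p = p * (2 * p' - 1) by
      rw [Nat.mul_sub, mul_one, mul_comm 2 p, mul_assoc, ← mul_assoc p], pow_mul, hKp]

lemma pow_pred_pow_half {M : Type*} [Monoid M] {k : M} {p : ℕ} (hp : p ≠ 0)
    (hk : k ^ (2 * p) = 1) : (k ^ (2 * p - 1)) ^ p = k ^ p := by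
  obtain ⟨n, rfl⟩ := Nat.exists_eq_succ_of_ne_zero hp
  rw [← pow_mul, show (2 * n.succ - 1) * n.succ = 2 * n.succ * n + n.succ by
    rw [show 2 * n.succ - 1 = 2 * n + 1 by omega, Nat.succ_eq_add_one]; ring, pow_add, pow_mul, hk,
    one_pow, one_mul]

/-- `g_{p₊,p₋}` is isomorphic to the quotient of
`Ū_{Q₊}(sl₂; p₊) ⊗ Ū_{Q₋}(sl₂; p₋)` by the ideal `(k^{p₊} ⊗ 1 − 1 ⊗ k^{p₋})`,
with the prescribed images of the generators. -/
theorem iso_to_tensor_quotient (pp pm : ℕ) (hpp : 2 ≤ pp) (hpm : 2 ≤ pm)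
    (hco : Nat.Coprime pp pm) :
    ∃ φ : QG pp pm ≃ₐ[ℂ] UTensQuot pp pm,
      φ (gen pp pm Ep) = RingQuot.mkAlgHom ℂ (KIdealRel pp pm)
          ((ugen (rootOfUnity pp ^ pm) pp UGen.e) ⊗ₜ[ℂ] 1) ∧
      φ (gen pp pm Fp) = RingQuot.mkAlgHom ℂ (KIdealRel pp pm)
          ((ugen (rootOfUnity pp ^ pm) pp UGen.f) ⊗ₜ[ℂ] 1) ∧
      φ (gen pp pm Em) = RingQuot.mkAlgHom ℂ (KIdealRel pp pm)
          (1 ⊗ₜ[ℂ] (ugen (rootOfUnity pm ^ pp) pm UGen.f)) ∧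
      φ (gen pp pm Fm) = RingQuot.mkAlgHom ℂ (KIdealRel pp pm)
          (1 ⊗ₜ[ℂ] (ugen (rootOfUnity pm ^ pp) pm UGen.e)) ∧
      φ (gen pp pm K ^ pm) = RingQuot.mkAlgHom ℂ (KIdealRel pp pm)
          ((ugen (rootOfUnity pp ^ pm) pp UGen.k) ⊗ₜ[ℂ] 1) ∧
      φ (gen pp pm K ^ pp) = RingQuot.mkAlgHom ℂ (KIdealRel pp pm)
          (1 ⊗ₜ[ℂ] (ugen (rootOfUnity pm ^ pp) pm UGen.k ^ (2 * pm - 1))) := by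
  let _ : Ring (UTensQuot pp pm) := Algebra.semiringToRing ℂ
  have hp : pp ≠ 0 := by omega
  have hp' : pm ≠ 0 := by omega
  have hQ : rootOfUnity pp ^ pm ≠ 0 := pow_ne_zero _ (rootOfUnity_ne_zero _)
  have hQ' : rootOfUnity pm ^ pp ≠ 0 := pow_ne_zero _ (rootOfUnity_ne_zero _)
  obtain ⟨a, b, m, hab⟩ := exists_bezout_modulo hpp hpm hco
  let π := RingQuot.mkAlgHom ℂ (KIdealRel pp pm)
  let i₁ : UQsl2 (rootOfUnity pp ^ pm) pp →ₐ[ℂ] UTensQuot pp pm :=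
    π.comp Algebra.TensorProduct.includeLeft
  let i₂ : UQsl2 (rootOfUnity pm ^ pp) pm →ₐ[ℂ] UTensQuot pp pm :=
    π.comp Algebra.TensorProduct.includeRight
  have hi : ∀ u v, Commute (i₁ u) (i₂ v) := fun u v =>
    Commute.map (f := π) (by simp [Commute, SemiconjBy])
  have t₁ := (IsUTriple.ugen (rootOfUnity pp ^ pm) pp).map i₁
  have t₂ := (IsUTriple.ugen (rootOfUnity pm ^ pp) pm).map i₂
  have hpow : i₁ (ugen _ _ UGen.k) ^ pp = i₂ (ugen _ _ UGen.k) ^ pm := by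
    have := RingQuot.mkAlgHom_rel ℂ (KIdealRel.rel (pp := pp) (pm := pm))
    rw [map_zero, map_sub, sub_eq_zero] at this
    rw [← map_pow, ← map_pow]
    exact this
  have s := t₁.isQGTuple (t₂.swap hp' hQ') hp hp' (hi _ _) (hi _ _) ((hi _ _).pow_right _)
    (hi _ _) (hi _ _) ((hi _ _).pow_right _) (hi _ _) (hi _ _) ((hi _ _).pow_right _)
    (hpow.trans (pow_pred_pow_half hp' t₂.k_pow).symm) hab
  have hxy : Commute (i₁ (ugen _ _ UGen.k)) (i₂ (ugen _ _ UGen.k) ^ (2 * pm - 1)) :=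
    (hi _ _).pow_right _
  have hK₁ := mul_pow_bezout hxy t₁.k_pow
    (hpow.trans (pow_pred_pow_half hp' t₂.k_pow).symm) hab
  have hK₂ := mul_pow_bezout hxy.symm (t₂.swap hp' hQ').k_pow
    (hpow.trans (pow_pred_pow_half hp' t₂.k_pow).symm).symm
    (show b * pp + a * pm = 1 + 2 * pm * pp * m by rw [add_comm, hab]; ring)
  rw [← (hxy.pow_pow a b).eq] at hK₂
  have g := IsQGTuple.gen pp pm
  have u₁ := g.isUTriple
  have u₂ := g.symm.isUTriple.swap hp' hQ'
  have hj : ∀ u v, Commute (u₁.lift u) (u₂.lift v) := by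
    refine UQsl2.commute_of_gen _ _ ?_
    rintro (_ | _ | _) (_ | _ | _) <;>
      simp only [IsUTriple.lift_e, IsUTriple.lift_f, IsUTriple.lift_k]
    · exact g.E_F'
    · exact g.E_E'
    · exact ((g.symm.commute_pow_E' hp).pow_left _).symm
    · exact g.F_F'
    · exact g.E'_F.symm
    · exact ((g.symm.commute_pow_F' hp).pow_left _).symm
    · exact g.commute_pow_F' hp'
    · exact g.commute_pow_E' hp'
    · exact ((Commute.refl _).pow_pow _ _).pow_right _
  let ψ : UTensQuot pp pm →ₐ[ℂ] QG pp pm :=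
    RingQuot.liftAlgHom ℂ ⟨Algebra.TensorProduct.lift u₁.lift u₂.lift hj, by
      rintro _ _ ⟨⟩
      simp only [map_sub, map_zero, Algebra.TensorProduct.lift_tmul, map_pow, map_one, mul_one,
        one_mul, IsUTriple.lift_k]
      rw [pow_pred_pow_half hp' g.symm.isUTriple.k_pow, ← pow_mul, ← pow_mul, mul_comm, sub_self]⟩
  have hψ₁ : ∀ u, ψ (i₁ u) = u₁.lift u := fun u => by simp [ψ, i₁, π]
  have hψ₂ : ∀ u, ψ (i₂ u) = u₂.lift u := fun u => by simp [ψ, i₂, π]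
  have h₁ : s.lift.comp ψ = AlgHom.id ℂ _ := by
    refine RingQuot.ringQuot_ext' ℂ _ _ (Algebra.TensorProduct.ext ?_ ?_)
    · refine UQsl2.algHom_ext fun x => ?_
      change s.lift (ψ (i₁ _)) = i₁ _
      rw [hψ₁]
      cases x <;> simp [hK₁]
    · refine UQsl2.algHom_ext fun x => ?_
      change s.lift (ψ (i₂ _)) = i₂ _
      rw [hψ₂]
      cases x
      · simp
      · simp
      · simp [hK₂, t₂.k_pow_pred_pow_pred hp']
  have h₂ : ψ.comp s.lift = AlgHom.id ℂ _ := by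
    refine QG.algHom_ext fun x => ?_
    cases x
    · simp [hψ₁]
    · simp [hψ₁]
    · simp [hψ₂]
    · simp [hψ₂]
    · simp only [AlgHom.comp_apply, IsQGTuple.lift_K, map_mul, map_pow, hψ₁, hψ₂,
        IsUTriple.lift_k, AlgHom.id_apply, g.symm.isUTriple.k_pow_pred_pow_pred hp']
      rw [← pow_mul, ← pow_mul, ← pow_add, mul_comm pm, mul_comm pp, hab, pow_add, pow_mul,
        g.K_pow, one_pow, pow_one, mul_one]
  refine ⟨AlgEquiv.ofAlgHom s.lift ψ h₁ h₂, s.lift_Ep, s.lift_Fp, s.lift_Em, s.lift_Fm, ?_, ?_⟩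
  · exact (map_pow s.lift _ _).trans (by rw [s.lift_K, hK₁]; rfl)
  · exact (map_pow s.lift _ _).trans (by rw [s.lift_K, hK₂, ← map_pow]; rfl)
end
end

section
/- In g_{p₊,p₋}, the Casimir elements satisfy ψ₊(C₊) = 0 and ψ₋(C₋) = 0, where ψ₊(x) = ∏_{r=0}^{p₊−1} (x + q₊^{p₋r} + q₊^{-p₋r})·(x − q₊^{p₋r} − q₊^{-p₋r}) ∈ ℂ[x] and ψ₋(x) = ∏_{r'=0}^{p₋−1} (x + q₋^{p₊r'} + q₋^{-p₊r'})·(x − q₋^{p₊r'} − q₋^{-p₊r'}) ∈ ℂ[x], evaluation being the ℂ-algebra evaluation map (Polynomial.aeval) at C₊ resp. C₋. -/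
noncomputable section

open FreeAlgebra QGGen

/-- The Casimir element `C₊` of `g_{p₊,p₋}`. -/
def CasP (pp pm : ℕ) : QG pp pm :=
  -(algebraMap ℂ (QG pp pm) (rootOfUnity pp ^ pm) * gen pp pm K ^ (2 * pp * pm - pm)) -
    algebraMap ℂ (QG pp pm) ((rootOfUnity pp ^ pm)⁻¹) * gen pp pm K ^ pm -
    algebraMap ℂ (QG pp pm) ((rootOfUnity pp ^ pm - (rootOfUnity pp ^ pm)⁻¹) ^ 2) *
      (gen pp pm Ep * gen pp pm Fp)

/-- The Casimir element `C₋` of `g_{p₊,p₋}`. -/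
def CasM (pp pm : ℕ) : QG pp pm :=
  -(algebraMap ℂ (QG pp pm) (rootOfUnity pm ^ pp) * gen pp pm K ^ (2 * pp * pm - pp)) -
    algebraMap ℂ (QG pp pm) ((rootOfUnity pm ^ pp)⁻¹) * gen pp pm K ^ pp -
    algebraMap ℂ (QG pp pm) ((rootOfUnity pm ^ pp - (rootOfUnity pm ^ pp)⁻¹) ^ 2) *
      (gen pp pm Em * gen pp pm Fm)

section Casimir

open Polynomial

/-- The square of `exp(iπ/p)^m` is a primitive `p`-th root of unity when `m` is prime to `p`. -/
theorem isPrimitiveRoot_rootOfUnity_pow_sq {p m : ℕ} (hp : p ≠ 0) (h : m.Coprime p) :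
    IsPrimitiveRoot ((rootOfUnity p ^ m) ^ 2) p := by
  have h1 : rootOfUnity p ^ 2 = Complex.exp (2 * Real.pi * Complex.I / p) := by
    rw [rootOfUnity, ← Complex.exp_nat_mul]
    congr 1
    push_cast
    ring
  rw [← pow_mul, mul_comm, pow_mul, h1]
  exact (Complex.isPrimitiveRoot_exp p hp).pow_of_coprime m h

/-- The `2p`-th roots of unity are the numbers `±ω ^ r` with `r < p`, when `ω ^ 2` is a primitive
`p`-th root of unity. -/
theorem prod_nthRootsFinset_two_mul {M : Type*} [CommMonoid M] {p : ℕ} (hp : p ≠ 0) {ω : ℂ}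
    (hω : IsPrimitiveRoot (ω ^ 2) p) (f : ℂ → M) :
    ∏ ζ ∈ nthRootsFinset (2 * p) (1 : ℂ), f ζ =
      ∏ r ∈ Finset.range p, f (ω ^ r) * f (-ω ^ r) := by
  have hω0 : ω ≠ 0 := fun h => hω.ne_zero hp (by simp [h])
  let g : ℕ × ℂ → ℂ := fun x => x.2 * ω ^ x.1
  have hmem : ∀ x ∈ Finset.range p ×ˢ ({1, -1} : Finset ℂ), x.1 < p ∧ x.2 ^ 2 = 1 := by
    intro x hx
    simp only [Finset.mem_product, Finset.mem_range, Finset.mem_insert,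
      Finset.mem_singleton] at hx
    refine ⟨hx.1, ?_⟩
    rcases hx.2 with h | h <;> simp [h]
  have hsq : ∀ x ∈ Finset.range p ×ˢ ({1, -1} : Finset ℂ), g x ^ 2 = (ω ^ 2) ^ x.1 := by
    intro x hx
    simp only [g]
    rw [mul_pow, (hmem x hx).2, one_mul, ← pow_mul, ← pow_mul, mul_comm]
  have hinj : Set.InjOn g (Finset.range p ×ˢ ({1, -1} : Finset ℂ) : Finset (ℕ × ℂ)) := by
    intro x hx y hy hxy
    rw [Finset.mem_coe] at hx hy
    have h1 : x.1 = y.1 := hω.pow_inj (hmem x hx).1 (hmem y hy).1 (by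
      rw [← hsq x hx, ← hsq y hy, hxy])
    refine Prod.ext h1 ?_
    simp only [g, h1] at hxy
    exact mul_right_cancel₀ (pow_ne_zero _ hω0) hxy
  have hprim : IsPrimitiveRoot (Complex.exp (2 * Real.pi * Complex.I / (2 * p : ℕ))) (2 * p) :=
    Complex.isPrimitiveRoot_exp (2 * p) (by omega)
  have himage : (Finset.range p ×ˢ ({1, -1} : Finset ℂ)).image g =
      nthRootsFinset (2 * p) (1 : ℂ) := by
    refine Finset.eq_of_subset_of_card_le ?_ ?_
    · intro ζ hζ
      obtain ⟨x, hx, rfl⟩ := Finset.mem_image.1 hζ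
      rw [mem_nthRootsFinset (by omega), pow_mul, hsq x hx, ← pow_mul, mul_comm, pow_mul,
        hω.pow_eq_one, one_pow]
    · rw [hprim.card_nthRootsFinset, Finset.card_image_of_injOn hinj, Finset.card_product,
        Finset.card_range, Finset.card_pair (by norm_num), mul_comm]
  rw [← himage, Finset.prod_image hinj, Finset.prod_product]
  refine Finset.prod_congr rfl fun r _ => ?_
  rw [Finset.prod_pair (by norm_num)]
  simp [g]

/-- An element of finite order in a `ℂ`-algebra is diagonalizable, so an element that
annihilates all its eigenvectors vanishes. -/
theorem eq_zero_of_mul_eigenvectors_eq_zero {A : Type*} [Ring A] [Algebra ℂ A] {n : ℕ}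
    (hn : n ≠ 0) {k a : A} (hk : k ^ n = 1)
    (h : ∀ (l : ℂ) (z : A), l ^ n = 1 → k * z = l • z → a * z = 0) : a = 0 := by
  have hprim := Complex.isPrimitiveRoot_exp n hn
  have hnod : Lagrange.nodal (nthRootsFinset n (1 : ℂ)) id = X ^ n - 1 := by
    rw [X_pow_sub_one_eq_prod (Nat.pos_of_ne_zero hn) hprim]
    rfl
  have hne : (nthRootsFinset n (1 : ℂ)).Nonempty :=
    ⟨1, (mem_nthRootsFinset (Nat.pos_of_ne_zero hn) 1).2 (one_pow n)⟩
  have hsum := congrArg (aeval k)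
    (Lagrange.sum_basis (s := nthRootsFinset n (1 : ℂ)) (v := id) Function.injective_id.injOn hne)
  rw [map_sum, map_one] at hsum
  rw [← mul_one a, ← hsum, Finset.mul_sum]
  refine Finset.sum_eq_zero fun l hl =>
    h l _ ((mem_nthRootsFinset (Nat.pos_of_ne_zero hn) 1).1 hl) ?_
  have h1 : (X - C l) * Lagrange.basis (nthRootsFinset n (1 : ℂ)) id l =
      C (Lagrange.nodalWeight (nthRootsFinset n (1 : ℂ)) id l) * (X ^ n - 1) := by
    rw [Lagrange.basis_eq_prod_sub_inv_mul_nodal_div hl, ← hnod,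
      ← Lagrange.nodal_erase_eq_nodal_div hl, mul_left_comm,
      Lagrange.nodal_eq_mul_nodal_erase hl, id]
  have h2 := congrArg (aeval k) h1
  simp only [map_mul, map_sub, map_pow, aeval_X, aeval_C, map_one, hk, sub_self, mul_zero] at h2
  rwa [sub_mul, sub_eq_zero, ← Algebra.smul_def] at h2

section SmallQuantumGroup

variable {A : Type*} [Ring A] [Algebra ℂ A] {ω : ℂ} {E F k k' c : A}

/-- The quantum Casimir element commutes with the raising operator. -/
theorem commute_casimir (hω : ω ≠ 0) (hk'k : k' * k = 1) (hkk' : k * k' = 1)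
    (hkE : k * E = ω ^ 2 • (E * k)) (hEF : E * F - F * E = (ω - ω⁻¹)⁻¹ • (k - k'))
    (hc : c = -(ω • k') - ω⁻¹ • k - (ω - ω⁻¹) ^ 2 • (E * F)) : c * E = E * c := by
  have hk'E : k' * E = (ω ^ 2)⁻¹ • (E * k') := by
    have h : E * k' = ω ^ 2 • (k' * E) := by
      calc E * k' = k' * (k * E) * k' := by rw [← mul_assoc k', hk'k, one_mul]
        _ = ω ^ 2 • (k' * E * (k * k')) := by
          rw [hkE, mul_smul_comm, smul_mul_assoc]; simp only [mul_assoc]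
        _ = ω ^ 2 • (k' * E) := by rw [hkk', mul_one]
    rw [h, smul_smul, inv_mul_cancel₀ (pow_ne_zero 2 hω), one_smul]
  have hEFE : E * F * E = E * (E * F) - (ω - ω⁻¹)⁻¹ • (E * k - E * k') := by
    rw [← mul_sub, ← mul_smul_comm, ← hEF, mul_assoc, ← mul_sub]
    congr 1
    abel
  have e1 : (ω - ω⁻¹) ^ 2 * (ω - ω⁻¹)⁻¹ = ω - ω⁻¹ := by field_simp
  have e2 : ω * (ω ^ 2)⁻¹ = ω⁻¹ := by field_simp
  have e3 : ω⁻¹ * ω ^ 2 = ω := by field_simp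
  rw [hc]
  simp only [sub_mul, mul_sub, neg_mul, mul_neg, smul_mul_assoc, mul_smul_comm, hk'E, hkE, hEFE,
    smul_sub, smul_smul, e1, e2, e3]
  module

/-- The action of `E ^ m * F ^ m` on a weight vector, in terms of the Casimir element. -/
theorem pow_mul_pow_mul_eigenvector (hω : ω ≠ 0) (hk'k : k' * k = 1)
    (hkF : k * F = (ω ^ 2)⁻¹ • (F * k)) (hcE : c * E = E * c)
    (hc : c = -(ω • k') - ω⁻¹ • k - (ω - ω⁻¹) ^ 2 • (E * F)) {l : ℂ} (hl : l ≠ 0) {z : A}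
    (hz : k * z = l • z) (m : ℕ) :
    (-(ω - ω⁻¹) ^ 2) ^ m • (E ^ m * F ^ m * z) =
      aeval c (∏ s ∈ Finset.range m, (X + C (ω * (ω ^ 2) ^ s * l⁻¹ + (ω * (ω ^ 2) ^ s * l⁻¹)⁻¹))) *
        z := by
  have hEFw : ∀ (u : ℂ) (w : A), u ≠ 0 → k * w = u • w →
      (-(ω - ω⁻¹) ^ 2) • (E * F * w) = (c + algebraMap ℂ A (ω * u⁻¹ + ω⁻¹ * u)) * w := by
    intro u w hu hw
    have hw' : k' * w = u⁻¹ • w := by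
      calc k' * w = u⁻¹ • (k' * (u • w)) := by
            rw [mul_smul_comm, smul_smul, inv_mul_cancel₀ hu, one_smul]
        _ = u⁻¹ • w := by rw [← hw, ← mul_assoc, hk'k, one_mul]
    rw [add_mul, ← Algebra.smul_def, hc]
    simp only [sub_mul, neg_mul, smul_mul_assoc, hw, hw', smul_smul]
    module
  have hF : ∀ m : ℕ, k * (F ^ m * z) = (((ω ^ 2)⁻¹) ^ m * l) • (F ^ m * z) := by
    intro m
    induction m with
    | zero => simpa using hz
    | succ m ih =>
      rw [pow_succ' F, mul_assoc, ← mul_assoc, hkF, smul_mul_assoc, mul_assoc, ih,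
        mul_smul_comm, smul_smul, pow_succ' (ω ^ 2)⁻¹, mul_assoc]
  induction m with
  | zero => simp
  | succ m ih =>
    have hcm : c * E ^ m = E ^ m * c := (Commute.pow_right hcE m :)
    have hconst : ω * (ω ^ 2) ^ m * l⁻¹ + (ω * (ω ^ 2) ^ m * l⁻¹)⁻¹ =
        ω * (((ω ^ 2)⁻¹) ^ m * l)⁻¹ + ω⁻¹ * (((ω ^ 2)⁻¹) ^ m * l) := by
      simp only [mul_inv, inv_pow, inv_inv]
      ring
    have hu : ((ω ^ 2)⁻¹) ^ m * l ≠ 0 :=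
      mul_ne_zero (pow_ne_zero _ (inv_ne_zero (pow_ne_zero 2 hω))) hl
    rw [Finset.prod_range_succ_comm, map_mul, mul_assoc (aeval c _), ← ih, hconst, mul_smul_comm]
    rw [map_add, aeval_X, aeval_C, pow_succ (-(ω - ω⁻¹) ^ 2), mul_smul]
    congr 1
    calc -(ω - ω⁻¹) ^ 2 • (E ^ (m + 1) * F ^ (m + 1) * z)
        = E ^ m * (-(ω - ω⁻¹) ^ 2 • (E * F * (F ^ m * z))) := by
          rw [pow_succ E, pow_succ' F, mul_smul_comm]; simp only [mul_assoc]
      _ = _ := by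
          rw [hEFw _ _ hu (hF m), ← mul_assoc, mul_add, ← hcm, ← Algebra.commutes, ← add_mul]
          simp only [mul_assoc]

/-- The polynomial relation satisfied by the Casimir element of the restricted quantum group of
`sl₂` at a root of unity. -/
theorem aeval_casimir_eq_zero {p : ℕ} (hp : 2 ≤ p) (hω : IsPrimitiveRoot (ω ^ 2) p)
    (hE : E ^ p = 0) (hk : k ^ (2 * p) = 1) (hk'k : k' * k = 1) (hkk' : k * k' = 1)
    (hkE : k * E = ω ^ 2 • (E * k)) (hkF : k * F = (ω ^ 2)⁻¹ • (F * k))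
    (hEF : E * F - F * E = (ω - ω⁻¹)⁻¹ • (k - k'))
    (hc : c = -(ω • k') - ω⁻¹ • k - (ω - ω⁻¹) ^ 2 • (E * F)) :
    aeval c (∏ r ∈ Finset.range p, ((X : ℂ[X]) + C (ω ^ r + (ω ^ r)⁻¹)) *
      ((X : ℂ[X]) - C (ω ^ r + (ω ^ r)⁻¹))) = 0 := by
  have hp0 : p ≠ 0 := by omega
  have hω0 : ω ≠ 0 := fun h => hω.ne_zero hp0 (by simp [h])
  have hprod : ∏ r ∈ Finset.range p, ((X : ℂ[X]) + C (ω ^ r + (ω ^ r)⁻¹)) *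
      ((X : ℂ[X]) - C (ω ^ r + (ω ^ r)⁻¹)) =
      ∏ ζ ∈ nthRootsFinset (2 * p) (1 : ℂ), (X + C (ζ + ζ⁻¹)) := by
    rw [prod_nthRootsFinset_two_mul hp0 hω]
    refine Finset.prod_congr rfl fun r _ => ?_
    rw [inv_neg, ← neg_add, C_neg, ← sub_eq_add_neg]
  rw [hprod]
  refine eq_zero_of_mul_eigenvectors_eq_zero (by omega : 2 * p ≠ 0) hk fun l z hl hz => ?_
  have hl0 : l ≠ 0 := by
    rintro rfl
    simp [hp0] at hl
  have key := pow_mul_pow_mul_eigenvector hω0 hk'k hkF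
    (commute_casimir hω0 hk'k hkk' hkE hEF hc) hc hl0 hz p
  rw [hE, zero_mul, zero_mul, smul_zero] at key
  have hinj : Set.InjOn (fun s : ℕ => ω * (ω ^ 2) ^ s * l⁻¹) (Finset.range p) := by
    intro s hs t ht hst
    refine hω.pow_inj (Finset.mem_range.1 hs) (Finset.mem_range.1 ht) ?_
    exact mul_left_cancel₀ hω0 (mul_right_cancel₀ (inv_ne_zero hl0) hst)
  have hdvd : ∏ s ∈ Finset.range p,
      (X + C (ω * (ω ^ 2) ^ s * l⁻¹ + (ω * (ω ^ 2) ^ s * l⁻¹)⁻¹)) ∣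
      ∏ ζ ∈ nthRootsFinset (2 * p) (1 : ℂ), (X + C (ζ + ζ⁻¹)) := by
    rw [← Finset.prod_image (f := fun ζ : ℂ => X + C (ζ + ζ⁻¹)) hinj]
    refine Finset.prod_dvd_prod_of_subset _ _ _ fun ζ hζ => ?_
    obtain ⟨s, -, rfl⟩ := Finset.mem_image.1 hζ
    rw [mem_nthRootsFinset (by omega), mul_pow, mul_pow, inv_pow, hl, inv_one, mul_one,
      pow_mul ω, hω.pow_eq_one, one_mul, ← pow_mul, mul_comm 2 p, mul_left_comm, pow_mul,
      hω.pow_eq_one, one_pow]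
  obtain ⟨R, hR⟩ := hdvd
  rw [hR, mul_comm, map_mul, mul_assoc, ← key, mul_zero]

end SmallQuantumGroup

/-- If `a` multiplies past `b` up to a scalar, so does every power of `a`. -/
theorem pow_mul_eq_smul_mul_pow {A : Type*} [Ring A] [Algebra ℂ A] {a b : A} {t : ℂ}
    (h : a * b = t • (b * a)) (m : ℕ) : a ^ m * b = t ^ m • (b * a ^ m) := by
  induction m with
  | zero => simp
  | succ m ih =>
    rw [pow_succ, mul_assoc, h, mul_smul_comm, ← mul_assoc, ih, smul_mul_assoc, smul_smul,
      ← pow_succ' t, mul_assoc]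

/-- A defining relation of `g_{p₊,p₋}` holds between the images of its two sides. -/
theorem mkAlgHom_eq_of_rel {pp pm : ℕ} {x y : FreeAlgebra ℂ QGGen} (h : QGRel pp pm x y) :
    RingQuot.mkAlgHom ℂ (QGRel pp pm) x = RingQuot.mkAlgHom ℂ (QGRel pp pm) y :=
  RingQuot.mkAlgHom_rel ℂ h

/-- The order relation of `K` in `g_{p₊,p₋}`. -/
theorem gen_K_pow (pp pm : ℕ) : gen pp pm K ^ (2 * pp * pm) = 1 := by
  simpa [gen] using mkAlgHom_eq_of_rel (QGRel.KOrd (pp := pp) (pm := pm))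

end Casimir

open Polynomial in
/-- The Casimir elements satisfy the polynomial relations `ψ₊(C₊) = 0` and `ψ₋(C₋) = 0`. -/
theorem casimir_min_poly (pp pm : ℕ) (hpp : 2 ≤ pp) (hpm : 2 ≤ pm)
    (hco : Nat.Coprime pp pm) :
    Polynomial.aeval (CasP pp pm)
        (∏ r ∈ Finset.range pp,
          ((X : ℂ[X]) + C (rootOfUnity pp ^ (pm * r) + (rootOfUnity pp ^ (pm * r))⁻¹)) *
            ((X : ℂ[X]) - C (rootOfUnity pp ^ (pm * r) + (rootOfUnity pp ^ (pm * r))⁻¹))) = 0 ∧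
    Polynomial.aeval (CasM pp pm)
        (∏ r' ∈ Finset.range pm,
          ((X : ℂ[X]) + C (rootOfUnity pm ^ (pp * r') + (rootOfUnity pm ^ (pp * r'))⁻¹)) *
            ((X : ℂ[X]) - C (rootOfUnity pm ^ (pp * r') + (rootOfUnity pm ^ (pp * r'))⁻¹))) = 0 := by
  have hpmle : pm ≤ 2 * pp * pm := Nat.le_mul_of_pos_left pm (by omega)
  have hpple : pp ≤ 2 * pp * pm := by
    rw [mul_comm 2 pp, mul_assoc]
    exact Nat.le_mul_of_pos_right pp (by omega)
  constructor
  · have h := aeval_casimir_eq_zero (A := QG pp pm) (p := pp) (ω := rootOfUnity pp ^ pm)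
      (E := gen pp pm Ep) (F := gen pp pm Fp) (k := gen pp pm K ^ pm)
      (k' := gen pp pm K ^ (2 * pp * pm - pm)) (c := CasP pp pm) hpp
      (isPrimitiveRoot_rootOfUnity_pow_sq (by omega) hco.symm)
      (by simpa [gen] using mkAlgHom_eq_of_rel (QGRel.EpNil (pp := pp) (pm := pm)))
      (by rw [← pow_mul, show pm * (2 * pp) = 2 * pp * pm by ring, gen_K_pow])
      (by rw [← pow_add, Nat.sub_add_cancel hpmle, gen_K_pow])
      (by rw [← pow_add, Nat.add_sub_cancel' hpmle, gen_K_pow])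
      (by
        rw [← pow_mul, mul_comm pm 2, pow_mul]
        refine pow_mul_eq_smul_mul_pow ?_ pm
        simpa [gen, Algebra.smul_def] using
          mkAlgHom_eq_of_rel (QGRel.KEp (pp := pp) (pm := pm)))
      (by
        rw [← pow_mul, mul_comm pm 2, pow_mul, ← inv_pow]
        refine pow_mul_eq_smul_mul_pow ?_ pm
        simpa [gen, Algebra.smul_def] using
          mkAlgHom_eq_of_rel (QGRel.KFp (pp := pp) (pm := pm)))
      (by
        simpa [gen, Algebra.smul_def] using
          mkAlgHom_eq_of_rel (QGRel.EpFp (pp := pp) (pm := pm)))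
      (by simp only [CasP, Algebra.smul_def])
    simpa only [pow_mul] using h
  · have h := aeval_casimir_eq_zero (A := QG pp pm) (p := pm) (ω := rootOfUnity pm ^ pp)
      (E := gen pp pm Em) (F := gen pp pm Fm) (k := gen pp pm K ^ pp)
      (k' := gen pp pm K ^ (2 * pp * pm - pp)) (c := CasM pp pm) hpm
      (isPrimitiveRoot_rootOfUnity_pow_sq (by omega) hco)
      (by simpa [gen] using mkAlgHom_eq_of_rel (QGRel.EmNil (pp := pp) (pm := pm)))
      (by rw [← pow_mul, show pp * (2 * pm) = 2 * pp * pm by ring, gen_K_pow])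
      (by rw [← pow_add, Nat.sub_add_cancel hpple, gen_K_pow])
      (by rw [← pow_add, Nat.add_sub_cancel' hpple, gen_K_pow])
      (by
        rw [← pow_mul, mul_comm pp 2, pow_mul]
        refine pow_mul_eq_smul_mul_pow ?_ pp
        simpa [gen, Algebra.smul_def] using
          mkAlgHom_eq_of_rel (QGRel.KEm (pp := pp) (pm := pm)))
      (by
        rw [← pow_mul, mul_comm pp 2, pow_mul, ← inv_pow]
        refine pow_mul_eq_smul_mul_pow ?_ pp
        simpa [gen, Algebra.smul_def] using
          mkAlgHom_eq_of_rel (QGRel.KFm (pp := pp) (pm := pm)))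
      (by
        simpa [gen, Algebra.smul_def] using
          mkAlgHom_eq_of_rel (QGRel.EmFm (pp := pp) (pm := pm)))
      (by simp only [CasM, Algebra.smul_def])
    simpa only [pow_mul] using h
end
end
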